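/- With 𝓛, 𝓜 as in the general commutation framework (drift terms b, b̃ smooth functions of (x, y, z_1, …, z_n)), the commutator satisfies: [𝓛,𝓜] + (4/(y−x)²)(𝓛 − 𝓜) = (κ∂_x b̃ − κ̃∂_y b)∂_{xy} + [2∂_x b/(y−x) + Σ_i 2∂_i b/(y−z_i) − b̃∂_y b + 2b/(y−x)² + (2κ−12)/(x−y)³ − (κ̃/2)∂_{yy}b]∂_x − [2∂_y b̃/(x−y) + Σ_i 2∂_i b̃/(x−z_i) − b∂_x b̃ + 2b̃/(x−y)² + (2κ̃−12)/(y−x)³ − (κ/2)∂_{xx}b̃]∂_y. -/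

import Mathlib

open scoped BigOperators

variable (n : ℕ)

/-- Configurations `(x, y, z₁, …, z_n)`. -/
abbrev Config (n : ℕ) := ℝ × ℝ × (Fin n → ℝ)

/-- The set of configurations with pairwise distinct points. -/
def distinctConfig (n : ℕ) : Set (Config n) :=
  {p | p.1 ≠ p.2.1 ∧ (∀ i, p.2.2 i ≠ p.1) ∧ (∀ i, p.2.2 i ≠ p.2.1) ∧
    ∀ i j, i ≠ j → p.2.2 i ≠ p.2.2 j}

/-- `∂ₓ`. -/
noncomputable def Dx (F : Config n → ℝ) : Config n → ℝ :=
  fun p => deriv (fun u => F (u, p.2.1, p.2.2)) p.1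

/-- `∂_y`. -/
noncomputable def Dy (F : Config n → ℝ) : Config n → ℝ :=
  fun p => deriv (fun u => F (p.1, u, p.2.2)) p.2.1

/-- `∂_{z_i}`. -/
noncomputable def Dz (i : Fin n) (F : Config n → ℝ) : Config n → ℝ :=
  fun p => deriv (fun u => F (p.1, p.2.1, Function.update p.2.2 i u)) (p.2.2 i)

/-- `𝓛 = (κ/2)∂ₓₓ + b ∂ₓ + (2/(y−x))∂_y + Σᵢ (2/(zᵢ−x))∂ᵢ`. -/
noncomputable def opL (κ : ℝ) (b : Config n → ℝ) (F : Config n → ℝ) : Config n → ℝ :=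
  fun p => κ / 2 * Dx n (Dx n F) p + b p * Dx n F p + 2 / (p.2.1 - p.1) * Dy n F p +
    ∑ i, 2 / (p.2.2 i - p.1) * Dz n i F p

/-- `𝓜 = (κ̃/2)∂_yy + b̃ ∂_y + (2/(x−y))∂ₓ + Σᵢ (2/(zᵢ−y))∂ᵢ`. -/
noncomputable def opM (κt : ℝ) (bt : Config n → ℝ) (F : Config n → ℝ) : Config n → ℝ :=
  fun p => κt / 2 * Dy n (Dy n F) p + bt p * Dy n F p + 2 / (p.1 - p.2.1) * Dx n F p +
    ∑ i, 2 / (p.2.2 i - p.2.1) * Dz n i F p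


/-- Directional derivative. -/
noncomputable def DD (v : Config n) (F : Config n → ℝ) : Config n → ℝ :=
  fun p => fderiv ℝ F p v

/-- Smoothness on the set of distinct configurations. -/
def Sm (F : Config n → ℝ) : Prop := ContDiffOn ℝ (⊤ : ℕ∞) F (distinctConfig n)

/-- x direction -/
def eX : Config n := (1, 0, 0)
/-- y direction -/
def eY : Config n := (0, 1, 0)
/-- z direction -/
def eZ (i : Fin n) : Config n := (0, 0, Pi.single i 1)

section
variable {n}

theorem isOpen_dc : IsOpen (distinctConfig n) := by
  have h1 : IsOpen {p : Config n | p.1 ≠ p.2.1} :=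
    isOpen_ne_fun (by fun_prop) (by fun_prop)
  have h2 : IsOpen {p : Config n | ∀ i, p.2.2 i ≠ p.1} := by
    simp only [Set.ofPred_forall]
    exact isOpen_iInter_of_finite fun i => isOpen_ne_fun (by fun_prop) (by fun_prop)
  have h3 : IsOpen {p : Config n | ∀ i, p.2.2 i ≠ p.2.1} := by
    simp only [Set.ofPred_forall]
    exact isOpen_iInter_of_finite fun i => isOpen_ne_fun (by fun_prop) (by fun_prop)
  have h4 : IsOpen {p : Config n | ∀ i j, i ≠ j → p.2.2 i ≠ p.2.2 j} := by
    simp only [Set.ofPred_forall]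
    exact isOpen_iInter_of_finite fun i => isOpen_iInter_of_finite fun j =>
      isOpen_iInter_of_finite fun h => isOpen_ne_fun (by fun_prop) (by fun_prop)
  exact h1.inter (h2.inter (h3.inter h4))

theorem Sm.cda {F : Config n → ℝ} (h : Sm n F) {p} (hp : p ∈ distinctConfig n) :
    ContDiffAt ℝ (⊤ : ℕ∞) F p := h.contDiffAt (isOpen_dc.mem_nhds hp)

theorem Sm.da {F : Config n → ℝ} (h : Sm n F) {p} (hp : p ∈ distinctConfig n) :
    DifferentiableAt ℝ F p := (h.cda hp).differentiableAt (by simp)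

theorem Sm.DD {F : Config n → ℝ} (h : Sm n F) (v : Config n) : Sm n (DD n v F) := by
  have := h.fderiv_of_isOpen (m := (⊤ : ℕ∞)) isOpen_dc (by simp)
  exact this.clm_apply contDiffOn_const

theorem DD_congr {F G : Config n → ℝ} (h : Set.EqOn F G (distinctConfig n)) (v : Config n) :
    Set.EqOn (DD n v F) (DD n v G) (distinctConfig n) := by
  intro p hp
  have : F =ᶠ[nhds p] G := h.eventuallyEq_of_mem (isOpen_dc.mem_nhds hp)
  simp only [DD, this.fderiv_eq]

theorem Sm.congr {F G : Config n → ℝ} (h : Sm n F) (e : Set.EqOn G F (distinctConfig n)) :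
    Sm n G := ContDiffOn.congr h e

theorem DD_add {F G : Config n → ℝ} (hF : Sm n F) (hG : Sm n G) (v : Config n) :
    Set.EqOn (DD n v (fun p => F p + G p)) (fun p => DD n v F p + DD n v G p)
      (distinctConfig n) := by
  intro p hp
  simp only [DD]
  rw [fderiv_fun_add (hF.da hp) (hG.da hp)]; rfl

theorem DD_mul {F G : Config n → ℝ} (hF : Sm n F) (hG : Sm n G) (v : Config n) :
    Set.EqOn (DD n v (fun p => F p * G p)) (fun p => DD n v F p * G p + F p * DD n v G p)
      (distinctConfig n) := by
  intro p hp
  simp only [DD]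
  rw [fderiv_fun_mul (hF.da hp) (hG.da hp)]
  simp; ring

theorem DD_sum {F : Fin n → Config n → ℝ} (hF : ∀ i, Sm n (F i)) (v : Config n) :
    Set.EqOn (DD n v (fun p => ∑ i, F i p)) (fun p => ∑ i, DD n v (F i) p)
      (distinctConfig n) := by
  intro p hp
  simp only [DD]
  rw [fderiv_fun_sum (fun i _ => (hF i).da hp)]
  simp

theorem DD_const (c : ℝ) (v : Config n) (p : Config n) : DD n v (fun _ => c) p = 0 := by
  simp [DD]

theorem DD_comm {F : Config n → ℝ} (hF : Sm n F) (v w : Config n) :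
    Set.EqOn (DD n v (DD n w F)) (DD n w (DD n v F)) (distinctConfig n) := by
  intro p hp
  have hs : IsSymmSndFDerivAt ℝ F p := (hF.cda hp).isSymmSndFDerivAt
    (by simp only [minSmoothness_of_isRCLikeNormedField]; exact WithTop.coe_le_coe.2 le_top)
  have hd : DifferentiableAt ℝ (fderiv ℝ F) p :=
    ((hF.cda hp).fderiv_right (m := 1) (WithTop.coe_le_coe.2 le_top)).differentiableAt (by simp)
  have key : ∀ v w : Config n, DD n v (DD n w F) p = fderiv ℝ (fderiv ℝ F) p v w := by
    intro v w
    change fderiv ℝ (fun q => fderiv ℝ F q w) p v = _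
    rw [fderiv_clm_apply hd (differentiableAt_const w)]
    simp
  rw [key, key]
  exact hs v w

theorem Sm.add {F G : Config n → ℝ} (hF : Sm n F) (hG : Sm n G) : Sm n (fun p => F p + G p) :=
  ContDiffOn.add hF hG
theorem Sm.mul {F G : Config n → ℝ} (hF : Sm n F) (hG : Sm n G) : Sm n (fun p => F p * G p) :=
  ContDiffOn.mul hF hG
theorem Sm.sum {F : Fin n → Config n → ℝ} (hF : ∀ i, Sm n (F i)) : Sm n (fun p => ∑ i, F i p) :=
  ContDiffOn.sum fun i _ => hF i
theorem Sm.const (c : ℝ) : Sm n (fun _ => c) := contDiffOn_const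

theorem Dx_eq {F : Config n → ℝ} (hF : Sm n F) :
    Set.EqOn (Dx n F) (DD n (eX n) F) (distinctConfig n) := by
  intro p hp
  have h1 : HasDerivAt (fun u : ℝ => ((u, p.2.1, p.2.2) : Config n)) (eX n) p.1 :=
    (hasDerivAt_id p.1).prodMk ((hasDerivAt_const _ _).prodMk (hasDerivAt_const _ _))
  exact (HasFDerivAt.comp_hasDerivAt (f := fun u : ℝ => ((u, p.2.1, p.2.2) : Config n)) p.1
    (hF.da hp).hasFDerivAt h1).deriv

theorem Dy_eq {F : Config n → ℝ} (hF : Sm n F) :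
    Set.EqOn (Dy n F) (DD n (eY n) F) (distinctConfig n) := by
  intro p hp
  have h1 : HasDerivAt (fun u : ℝ => ((p.1, u, p.2.2) : Config n)) (eY n) p.2.1 :=
    (hasDerivAt_const _ _).prodMk ((hasDerivAt_id _).prodMk (hasDerivAt_const _ _))
  exact (HasFDerivAt.comp_hasDerivAt (f := fun u : ℝ => ((p.1, u, p.2.2) : Config n)) p.2.1
    (hF.da hp).hasFDerivAt h1).deriv

theorem Dz_eq (i : Fin n) {F : Config n → ℝ} (hF : Sm n F) :
    Set.EqOn (Dz n i F) (DD n (eZ n i) F) (distinctConfig n) := by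
  intro p hp
  have h1 : HasDerivAt (fun u : ℝ => ((p.1, p.2.1, Function.update p.2.2 i u) : Config n))
      (eZ n i) (p.2.2 i) :=
    (hasDerivAt_const _ _).prodMk ((hasDerivAt_const _ _).prodMk (hasDerivAt_update _ _ _))
  have h2 : HasFDerivAt F (fderiv ℝ F p) (p.1, p.2.1, Function.update p.2.2 i (p.2.2 i)) := by
    rw [Function.update_eq_self]; exact (hF.da hp).hasFDerivAt
  exact (HasFDerivAt.comp_hasDerivAt
    (f := fun u : ℝ => ((p.1, p.2.1, Function.update p.2.2 i u) : Config n)) (p.2.2 i) h2 h1).deriv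

theorem Dxx_eq {F : Config n → ℝ} (hF : Sm n F) :
    Set.EqOn (Dx n (Dx n F)) (DD n (eX n) (DD n (eX n) F)) (distinctConfig n) := fun _ hp =>
  (Dx_eq ((hF.DD _).congr (Dx_eq hF)) hp).trans (DD_congr (Dx_eq hF) _ hp)
theorem Dyy_eq {F : Config n → ℝ} (hF : Sm n F) :
    Set.EqOn (Dy n (Dy n F)) (DD n (eY n) (DD n (eY n) F)) (distinctConfig n) := fun _ hp =>
  (Dy_eq ((hF.DD _).congr (Dy_eq hF)) hp).trans (DD_congr (Dy_eq hF) _ hp)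
theorem Dxy_eq {F : Config n → ℝ} (hF : Sm n F) :
    Set.EqOn (Dx n (Dy n F)) (DD n (eX n) (DD n (eY n) F)) (distinctConfig n) := fun _ hp =>
  (Dx_eq ((hF.DD _).congr (Dy_eq hF)) hp).trans (DD_congr (Dy_eq hF) _ hp)

/-- generic second order operator -/
noncomputable def PP (e f : Config n) (c : ℝ) (β γ : Config n → ℝ) (h : Fin n → Config n → ℝ)
    (F : Config n → ℝ) : Config n → ℝ := fun p =>
  c * DD n e (DD n e F) p + β p * DD n e F p + γ p * DD n f F p + ∑ i, h i p * DD n (eZ n i) F p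

theorem PP_sm (e f : Config n) (c : ℝ) {β γ : Config n → ℝ} {h : Fin n → Config n → ℝ}
    {F : Config n → ℝ} (hβ : Sm n β) (hγ : Sm n γ) (hh : ∀ i, Sm n (h i)) (hF : Sm n F) :
    Sm n (PP e f c β γ h F) :=
  ((((Sm.const c).mul ((hF.DD _).DD _)).add (hβ.mul (hF.DD _))).add (hγ.mul (hF.DD _))).add
    (Sm.sum fun i => (hh i).mul (hF.DD _))

theorem DD_PP (v e f : Config n) (c : ℝ) {β γ : Config n → ℝ} {h : Fin n → Config n → ℝ}
    {F : Config n → ℝ} (hβ : Sm n β) (hγ : Sm n γ) (hh : ∀ i, Sm n (h i)) (hF : Sm n F) :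
    Set.EqOn (DD n v (PP e f c β γ h F)) (fun p =>
      c * DD n v (DD n e (DD n e F)) p +
      (DD n v β p * DD n e F p + β p * DD n v (DD n e F) p) +
      (DD n v γ p * DD n f F p + γ p * DD n v (DD n f F) p) +
      ∑ i, (DD n v (h i) p * DD n (eZ n i) F p + h i p * DD n v (DD n (eZ n i) F) p))
      (distinctConfig n) := by
  intro p hp
  have s1 := (Sm.const c).mul ((hF.DD e).DD e)
  have s2 := hβ.mul (hF.DD e)
  have s3 := hγ.mul (hF.DD f)
  have s4 := fun i => (hh i).mul (hF.DD (eZ n i))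
  have a1 := DD_add ((s1.add s2).add s3) (Sm.sum s4) v hp
  have a2 := DD_add (s1.add s2) s3 v hp
  have a3 := DD_add s1 s2 v hp
  have a4 := DD_sum s4 v hp
  have a5 := DD_mul (Sm.const c) ((hF.DD e).DD e) v hp
  have a6 := DD_mul hβ (hF.DD e) v hp
  have a7 := DD_mul hγ (hF.DD f) v hp
  have a8 := fun i => DD_mul (hh i) (hF.DD (eZ n i)) v hp
  simp only [DD_const] at a1 a2 a3 a4 a5 a6 a7 a8
  refine a1.trans ?_
  rw [a2, a3, a4, a5, a6, a7]
  simp only [a8]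
  ring

theorem DDD_PP (v e f : Config n) (c : ℝ) {β γ : Config n → ℝ} {h : Fin n → Config n → ℝ}
    {F : Config n → ℝ} (hβ : Sm n β) (hγ : Sm n γ) (hh : ∀ i, Sm n (h i)) (hF : Sm n F)
    (h0 : ∀ i, Set.EqOn (DD n v (h i)) (fun _ => 0) (distinctConfig n)) :
    Set.EqOn (DD n v (DD n v (PP e f c β γ h F))) (fun p =>
      c * DD n v (DD n v (DD n e (DD n e F))) p +
      (DD n v (DD n v β) p * DD n e F p + 2 * DD n v β p * DD n v (DD n e F) p
        + β p * DD n v (DD n v (DD n e F)) p) +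
      (DD n v (DD n v γ) p * DD n f F p + 2 * DD n v γ p * DD n v (DD n f F) p
        + γ p * DD n v (DD n v (DD n f F)) p) +
      ∑ i, (h i p * DD n v (DD n v (DD n (eZ n i) F)) p))
      (distinctConfig n) := by
  intro p hp
  have e1 : Set.EqOn (DD n v (PP e f c β γ h F)) (fun p =>
      c * DD n v (DD n e (DD n e F)) p +
      (DD n v β p * DD n e F p + β p * DD n v (DD n e F) p) +
      (DD n v γ p * DD n f F p + γ p * DD n v (DD n f F) p) +
      ∑ i, (h i p * DD n v (DD n (eZ n i) F) p))
      (distinctConfig n) := by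
    intro q hq
    rw [DD_PP v e f c hβ hγ hh hF hq]
    simp only [h0 _ hq, zero_mul, zero_add]
  rw [DD_congr e1 v hp]
  have t1 := (Sm.const c).mul (((hF.DD e).DD e).DD v)
  have t2 := (hβ.DD v).mul (hF.DD e)
  have t3 := hβ.mul ((hF.DD e).DD v)
  have t4 := (hγ.DD v).mul (hF.DD f)
  have t5 := hγ.mul ((hF.DD f).DD v)
  have t6 := fun i => (hh i).mul ((hF.DD (eZ n i)).DD v)
  have a1 := DD_add ((t1.add (t2.add t3)).add (t4.add t5)) (Sm.sum t6) v hp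
  have a2 := DD_add (t1.add (t2.add t3)) (t4.add t5) v hp
  have a3 := DD_add t1 (t2.add t3) v hp
  have a4 := DD_add t2 t3 v hp
  have a5 := DD_add t4 t5 v hp
  have a6 := DD_sum t6 v hp
  have b1 := DD_mul (Sm.const c) (((hF.DD e).DD e).DD v) v hp
  have b2 := DD_mul (hβ.DD v) (hF.DD e) v hp
  have b3 := DD_mul hβ ((hF.DD e).DD v) v hp
  have b4 := DD_mul (hγ.DD v) (hF.DD f) v hp
  have b5 := DD_mul hγ ((hF.DD f).DD v) v hp
  have b6 := fun i => DD_mul (hh i) ((hF.DD (eZ n i)).DD v) v hp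
  simp only [DD_const] at a1 a2 a3 a4 a5 a6 b1 b2 b3 b4 b5 b6
  refine a1.trans ?_
  rw [a2, a3, a4, a5, a6, b1, b2, b3, b4, b5]
  simp only [b6, h0 _ hp]
  simp only [zero_mul, zero_add]
  ring

/-- derivative of a reciprocal of a linear functional -/
theorem DD_inv {l : Config n →L[ℝ] ℝ} (hl : ∀ p ∈ distinctConfig n, l p ≠ 0) (v : Config n) :
    Sm n (fun p => 2 / l p) ∧
    Set.EqOn (DD n v (fun p => 2 / l p)) (fun p => - 2 * l v / l p ^ 2) (distinctConfig n) ∧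
    Set.EqOn (DD n v (DD n v (fun p => 2 / l p))) (fun p => 4 * l v ^ 2 / l p ^ 3)
      (distinctConfig n) := by
  have h1 : Set.EqOn (DD n v (fun p => 2 / l p)) (fun p => - 2 * l v / l p ^ 2)
      (distinctConfig n) := by
    intro p hp
    have := ((hasDerivAt_inv (hl p hp)).comp_hasFDerivAt p l.hasFDerivAt).const_mul 2
    have e : (fun p => 2 / l p) = fun p => 2 * ((fun y => y⁻¹) ∘ l) p := by
      ext p; simp [div_eq_mul_inv]
    simp only [DD]
    rw [e, this.fderiv]
    simp
    ring
  refine ⟨contDiffOn_const.div l.contDiff.contDiffOn hl, h1, ?_⟩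
  intro p hp
  rw [DD_congr h1 v hp]
  have := ((((hasDerivAt_id (l p)).pow 2).inv (pow_ne_zero 2 (hl p hp))).comp_hasFDerivAt p
    l.hasFDerivAt).const_mul (-2 * l v)
  have e : (fun p => -2 * l v / l p ^ 2) = fun p => (-2 * l v) * (((id ^ 2 : ℝ → ℝ)⁻¹) ∘ l) p := by
    ext p; simp [div_eq_mul_inv]
  simp only [DD]
  rw [e, this.fderiv]
  have := hl p hp
  simp
  field_simp
  ring

theorem PP_apply (e f : Config n) (c : ℝ) (β γ : Config n → ℝ) (h : Fin n → Config n → ℝ)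
    (F : Config n → ℝ) (p : Config n) : PP e f c β γ h F p =
  c * DD n e (DD n e F) p + β p * DD n e F p + γ p * DD n f F p +
    ∑ i, h i p * DD n (eZ n i) F p := rfl

/-- coordinate functional -/
noncomputable def cX : Config n →L[ℝ] ℝ := ContinuousLinearMap.fst ℝ ℝ (ℝ × (Fin n → ℝ))
/-- coordinate functional -/
noncomputable def cY : Config n →L[ℝ] ℝ :=
  (ContinuousLinearMap.fst ℝ ℝ (Fin n → ℝ)).comp (ContinuousLinearMap.snd ℝ ℝ (ℝ × (Fin n → ℝ)))
/-- coordinate functional -/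
noncomputable def cZ (i : Fin n) : Config n →L[ℝ] ℝ :=
  (ContinuousLinearMap.proj (R := ℝ) (φ := fun _ : Fin n => ℝ) i).comp
    ((ContinuousLinearMap.snd ℝ ℝ (Fin n → ℝ)).comp
      (ContinuousLinearMap.snd ℝ ℝ (ℝ × (Fin n → ℝ))))

theorem cX_apply (p : Config n) : cX p = p.1 := rfl
theorem cY_apply (p : Config n) : cY p = p.2.1 := rfl
theorem cZ_apply (i : Fin n) (p : Config n) : cZ i p = p.2.2 i := rfl

/-- coefficient -/
noncomputable def gM : Config n → ℝ := fun p => 2 / (p.1 - p.2.1)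
/-- coefficient -/
noncomputable def gL : Config n → ℝ := fun p => 2 / (p.2.1 - p.1)
/-- coefficient -/
noncomputable def hM (i : Fin n) : Config n → ℝ := fun p => 2 / (p.2.2 i - p.2.1)
/-- coefficient -/
noncomputable def hL (i : Fin n) : Config n → ℝ := fun p => 2 / (p.2.2 i - p.1)

theorem gM_info (v : Config n) : Sm n gM ∧
    Set.EqOn (DD n v gM) (fun p => - 2 * (v.1 - v.2.1) / (p.1 - p.2.1) ^ 2) (distinctConfig n) ∧
    Set.EqOn (DD n v (DD n v gM)) (fun p => 4 * (v.1 - v.2.1) ^ 2 / (p.1 - p.2.1) ^ 3)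
      (distinctConfig n) :=
  DD_inv (l := cX - cY) (fun _ hp => sub_ne_zero.2 hp.1) v

theorem gL_info (v : Config n) : Sm n gL ∧
    Set.EqOn (DD n v gL) (fun p => - 2 * (v.2.1 - v.1) / (p.2.1 - p.1) ^ 2) (distinctConfig n) ∧
    Set.EqOn (DD n v (DD n v gL)) (fun p => 4 * (v.2.1 - v.1) ^ 2 / (p.2.1 - p.1) ^ 3)
      (distinctConfig n) :=
  DD_inv (l := cY - cX) (fun _ hp => sub_ne_zero.2 hp.1.symm) v

theorem hM_info (i : Fin n) (v : Config n) : Sm n (hM i) ∧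
    Set.EqOn (DD n v (hM i)) (fun p => - 2 * (v.2.2 i - v.2.1) / (p.2.2 i - p.2.1) ^ 2)
      (distinctConfig n) :=
  have h := DD_inv (l := cZ i - cY) (fun _ hp => sub_ne_zero.2 (hp.2.2.1 i)) v
  ⟨h.1, h.2.1⟩

theorem hL_info (i : Fin n) (v : Config n) : Sm n (hL i) ∧
    Set.EqOn (DD n v (hL i)) (fun p => - 2 * (v.2.2 i - v.1) / (p.2.2 i - p.1) ^ 2)
      (distinctConfig n) :=
  have h := DD_inv (l := cZ i - cX) (fun _ hp => sub_ne_zero.2 (hp.2.1 i)) v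
  ⟨h.1, h.2.1⟩

theorem opL_eq (κ : ℝ) (b : Config n → ℝ) {F : Config n → ℝ} (hF : Sm n F) :
    Set.EqOn (opL n κ b F) (PP (eX n) (eY n) (κ / 2) b gL hL F) (distinctConfig n) := by
  intro p hp
  simp only [opL, PP, Dxx_eq hF hp, Dx_eq hF hp, Dy_eq hF hp, Dz_eq _ hF hp, gL, hL]

theorem opM_eq (κ : ℝ) (b : Config n → ℝ) {F : Config n → ℝ} (hF : Sm n F) :
    Set.EqOn (opM n κ b F) (PP (eY n) (eX n) (κ / 2) b gM hM F) (distinctConfig n) := by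
  intro p hp
  simp only [opM, PP, Dyy_eq hF hp, Dx_eq hF hp, Dy_eq hF hp, Dz_eq _ hF hp, gM, hM]

theorem PP_congr (e f : Config n) (c : ℝ) (β γ : Config n → ℝ) (h : Fin n → Config n → ℝ)
    {F G : Config n → ℝ} (hFG : Set.EqOn F G (distinctConfig n)) :
    Set.EqOn (PP e f c β γ h F) (PP e f c β γ h G) (distinctConfig n) := by
  intro p hp
  simp only [PP, DD_congr hFG _ hp, DD_congr (DD_congr hFG _) _ hp]

theorem sum_delta (c : Fin n → ℝ) (i : Fin n) :
    ∑ j, (Pi.single i (1 : ℝ) : Fin n → ℝ) j * c j = c i := by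
  simp [Pi.single_apply]

theorem LM_eq (κ κt : ℝ) (b bt : Config n → ℝ) (hbt : Sm n bt)
    (F : Config n → ℝ) (hF : Sm n F) (p : Config n) (hp : p ∈ distinctConfig n) :
    opL n κ b (opM n κt bt F) p =
     κ / 2 * (κt / 2 * DD n (eX n) (DD n (eX n) (DD n (eY n) (DD n (eY n) F))) p +
        (DD n (eX n) (DD n (eX n) bt) p * DD n (eY n) F p
          + 2 * DD n (eX n) bt p * DD n (eX n) (DD n (eY n) F) p
          + bt p * DD n (eX n) (DD n (eX n) (DD n (eY n) F)) p) +
        (4 / (p.1 - p.2.1) ^ 3 * DD n (eX n) F p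
          + 2 * (-2 / (p.1 - p.2.1) ^ 2) * DD n (eX n) (DD n (eX n) F) p
          + gM p * DD n (eX n) (DD n (eX n) (DD n (eX n) F)) p) +
        ∑ i, hM i p * DD n (eX n) (DD n (eX n) (DD n (eZ n i) F)) p) +
     b p * (κt / 2 * DD n (eX n) (DD n (eY n) (DD n (eY n) F)) p +
        (DD n (eX n) bt p * DD n (eY n) F p + bt p * DD n (eX n) (DD n (eY n) F) p) +
        (-2 / (p.1 - p.2.1) ^ 2 * DD n (eX n) F p + gM p * DD n (eX n) (DD n (eX n) F) p) +
        ∑ i, hM i p * DD n (eX n) (DD n (eZ n i) F) p) +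
     gL p * (κt / 2 * DD n (eY n) (DD n (eY n) (DD n (eY n) F)) p +
        (DD n (eY n) bt p * DD n (eY n) F p + bt p * DD n (eY n) (DD n (eY n) F) p) +
        (2 / (p.1 - p.2.1) ^ 2 * DD n (eX n) F p + gM p * DD n (eY n) (DD n (eX n) F) p) +
        (∑ i, 2 / (p.2.2 i - p.2.1) ^ 2 * DD n (eZ n i) F p +
          ∑ i, hM i p * DD n (eY n) (DD n (eZ n i) F) p)) +
     ∑ j, hL j p * (κt / 2 * DD n (eZ n j) (DD n (eY n) (DD n (eY n) F)) p +
        (DD n (eZ n j) bt p * DD n (eY n) F p + bt p * DD n (eZ n j) (DD n (eY n) F) p) +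
        (gM p * DD n (eZ n j) (DD n (eX n) F) p) +
        (-2 / (p.2.2 j - p.2.1) ^ 2 * DD n (eZ n j) F p +
          ∑ i, hM i p * DD n (eZ n j) (DD n (eZ n i) F) p)) := by
  have hg : Sm n (gM (n := n)) := (gM_info 0).1
  have hh : ∀ i, Sm n (hM i) := fun i => (hM_info i 0).1
  have h0 : ∀ i, Set.EqOn (DD n (eX n) (hM i)) (fun _ => 0) (distinctConfig n) := by
    intro i q hq
    rw [(hM_info i _).2 hq]; simp [eX]
  have hG := PP_sm (eY n) (eX n) (κt / 2) hbt hg hh hF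
  rw [opL_eq κ b (hG.congr (opM_eq κt bt hF)) hp, PP_congr _ _ _ _ _ _ (opM_eq κt bt hF) hp]
  rw [PP_apply]
  rw [DDD_PP (eX n) (eY n) (eX n) (κt / 2) hbt hg hh hF h0 hp]
  simp only [DD_PP _ (eY n) (eX n) (κt / 2) hbt hg hh hF hp, (gM_info _).2.1 hp,
    (gM_info _).2.2 hp, (hM_info _ _).2 hp, Finset.sum_add_distrib]
  have e1 : ∀ j, ∑ i, -2 * ((eZ n j).2.2 i - (eZ n j).2.1) / (p.2.2 i - p.2.1) ^ 2 *
      DD n (eZ n i) F p = -2 / (p.2.2 j - p.2.1) ^ 2 * DD n (eZ n j) F p := by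
    intro j
    rw [← sum_delta (fun j => -2 / (p.2.2 j - p.2.1) ^ 2 * DD n (eZ n j) F p) j]
    refine Finset.sum_congr rfl fun i _ => ?_
    simp only [eZ]
    ring
  simp only [e1]
  simp [eX, eY, eZ]

theorem ML_eq (κ κt : ℝ) (b bt : Config n → ℝ) (hb : Sm n b)
    (F : Config n → ℝ) (hF : Sm n F) (p : Config n) (hp : p ∈ distinctConfig n) :
    opM n κt bt (opL n κ b F) p =
     κt / 2 * (κ / 2 * DD n (eY n) (DD n (eY n) (DD n (eX n) (DD n (eX n) F))) p +
        (DD n (eY n) (DD n (eY n) b) p * DD n (eX n) F p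
          + 2 * DD n (eY n) b p * DD n (eY n) (DD n (eX n) F) p
          + b p * DD n (eY n) (DD n (eY n) (DD n (eX n) F)) p) +
        (4 / (p.2.1 - p.1) ^ 3 * DD n (eY n) F p
          + 2 * (-2 / (p.2.1 - p.1) ^ 2) * DD n (eY n) (DD n (eY n) F) p
          + gL p * DD n (eY n) (DD n (eY n) (DD n (eY n) F)) p) +
        ∑ i, hL i p * DD n (eY n) (DD n (eY n) (DD n (eZ n i) F)) p) +
     bt p * (κ / 2 * DD n (eY n) (DD n (eX n) (DD n (eX n) F)) p +
        (DD n (eY n) b p * DD n (eX n) F p + b p * DD n (eY n) (DD n (eX n) F) p) +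
        (-2 / (p.2.1 - p.1) ^ 2 * DD n (eY n) F p + gL p * DD n (eY n) (DD n (eY n) F) p) +
        ∑ i, hL i p * DD n (eY n) (DD n (eZ n i) F) p) +
     gM p * (κ / 2 * DD n (eX n) (DD n (eX n) (DD n (eX n) F)) p +
        (DD n (eX n) b p * DD n (eX n) F p + b p * DD n (eX n) (DD n (eX n) F) p) +
        (2 / (p.2.1 - p.1) ^ 2 * DD n (eY n) F p + gL p * DD n (eX n) (DD n (eY n) F) p) +
        (∑ i, 2 / (p.2.2 i - p.1) ^ 2 * DD n (eZ n i) F p +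
          ∑ i, hL i p * DD n (eX n) (DD n (eZ n i) F) p)) +
     ∑ j, hM j p * (κ / 2 * DD n (eZ n j) (DD n (eX n) (DD n (eX n) F)) p +
        (DD n (eZ n j) b p * DD n (eX n) F p + b p * DD n (eZ n j) (DD n (eX n) F) p) +
        (gL p * DD n (eZ n j) (DD n (eY n) F) p) +
        (-2 / (p.2.2 j - p.1) ^ 2 * DD n (eZ n j) F p +
          ∑ i, hL i p * DD n (eZ n j) (DD n (eZ n i) F) p)) := by
  have hg : Sm n (gL (n := n)) := (gL_info 0).1
  have hh : ∀ i, Sm n (hL i) := fun i => (hL_info i 0).1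
  have h0 : ∀ i, Set.EqOn (DD n (eY n) (hL i)) (fun _ => 0) (distinctConfig n) := by
    intro i q hq
    rw [(hL_info i _).2 hq]; simp [eY]
  have hG := PP_sm (eX n) (eY n) (κ / 2) hb hg hh hF
  rw [opM_eq κt bt (hG.congr (opL_eq κ b hF)) hp, PP_congr _ _ _ _ _ _ (opL_eq κ b hF) hp]
  rw [PP_apply]
  rw [DDD_PP (eY n) (eX n) (eY n) (κ / 2) hb hg hh hF h0 hp]
  simp only [DD_PP _ (eX n) (eY n) (κ / 2) hb hg hh hF hp, (gL_info _).2.1 hp,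
    (gL_info _).2.2 hp, (hL_info _ _).2 hp, Finset.sum_add_distrib]
  have e1 : ∀ j, ∑ i, -2 * ((eZ n j).2.2 i - (eZ n j).1) / (p.2.2 i - p.1) ^ 2 *
      DD n (eZ n i) F p = -2 / (p.2.2 j - p.1) ^ 2 * DD n (eZ n j) F p := by
    intro j
    rw [← sum_delta (fun j => -2 / (p.2.2 j - p.1) ^ 2 * DD n (eZ n j) F p) j]
    refine Finset.sum_congr rfl fun i _ => ?_
    simp only [eZ]
    ring
  simp only [e1]
  simp [eX, eY, eZ]

theorem alg (κ κt x y b bt bx bY byy btx bty btxx Fx Fy Fxx Fxy Fyy Fxxx Fyyy Fxxy Fxyy Fxxyy : ℝ)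
    (z bz btz Fz Fxz Fyz Fxxz Fyyz : Fin n → ℝ) (Fzz : Fin n → Fin n → ℝ)
    (hxy : x ≠ y) (hzx : ∀ i, z i ≠ x) (hzy : ∀ i, z i ≠ y) (hs : ∀ i j, Fzz i j = Fzz j i) :
    (κ / 2 * (κt / 2 * Fxxyy + (btxx * Fy + 2 * btx * Fxy + bt * Fxxy) +
        (4 / (x - y) ^ 3 * Fx + 2 * (-2 / (x - y) ^ 2) * Fxx + 2 / (x - y) * Fxxx) +
        ∑ i, 2 / (z i - y) * Fxxz i) +
     b * (κt / 2 * Fxyy + (btx * Fy + bt * Fxy) +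
        (-2 / (x - y) ^ 2 * Fx + 2 / (x - y) * Fxx) + ∑ i, 2 / (z i - y) * Fxz i) +
     2 / (y - x) * (κt / 2 * Fyyy + (bty * Fy + bt * Fyy) +
        (2 / (x - y) ^ 2 * Fx + 2 / (x - y) * Fxy) +
        (∑ i, 2 / (z i - y) ^ 2 * Fz i + ∑ i, 2 / (z i - y) * Fyz i)) +
     ∑ j, 2 / (z j - x) * (κt / 2 * Fyyz j + (btz j * Fy + bt * Fyz j) +
        (2 / (x - y) * Fxz j) +
        (-2 / (z j - y) ^ 2 * Fz j + ∑ i, 2 / (z i - y) * Fzz j i))) -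
    (κt / 2 * (κ / 2 * Fxxyy + (byy * Fx + 2 * bY * Fxy + b * Fxyy) +
        (4 / (y - x) ^ 3 * Fy + 2 * (-2 / (y - x) ^ 2) * Fyy + 2 / (y - x) * Fyyy) +
        ∑ i, 2 / (z i - x) * Fyyz i) +
     bt * (κ / 2 * Fxxy + (bY * Fx + b * Fxy) +
        (-2 / (y - x) ^ 2 * Fy + 2 / (y - x) * Fyy) + ∑ i, 2 / (z i - x) * Fyz i) +
     2 / (x - y) * (κ / 2 * Fxxx + (bx * Fx + b * Fxx) +
        (2 / (y - x) ^ 2 * Fy + 2 / (y - x) * Fxy) +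
        (∑ i, 2 / (z i - x) ^ 2 * Fz i + ∑ i, 2 / (z i - x) * Fxz i)) +
     ∑ j, 2 / (z j - y) * (κ / 2 * Fxxz j + (bz j * Fx + b * Fxz j) +
        (2 / (y - x) * Fyz j) +
        (-2 / (z j - x) ^ 2 * Fz j + ∑ i, 2 / (z i - x) * Fzz j i))) +
    4 / (y - x) ^ 2 * ((κ / 2 * Fxx + b * Fx + 2 / (y - x) * Fy + ∑ i, 2 / (z i - x) * Fz i) -
      (κt / 2 * Fyy + bt * Fy + 2 / (x - y) * Fx + ∑ i, 2 / (z i - y) * Fz i)) =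
    (κ * btx - κt * bY) * Fxy +
      (2 * bx / (y - x) + (∑ i, 2 * bz i / (y - z i)) - bt * bY + 2 * b / (y - x) ^ 2 +
        (2 * κ - 12) / (x - y) ^ 3 - κt / 2 * byy) * Fx -
      (2 * bty / (x - y) + (∑ i, 2 * btz i / (x - z i)) - b * btx + 2 * bt / (x - y) ^ 2 +
        (2 * κt - 12) / (y - x) ^ 3 - κ / 2 * btxx) * Fy := by
  have hr : y - x ≠ 0 := sub_ne_zero.2 hxy.symm
  have hr' : x - y = -(y - x) := by ring
  have k1 : ∀ i, 2 * bz i / (y - z i) = -(2 / (z i - y) * bz i) := by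
    intro i
    rw [← neg_sub (z i) y, div_neg]; ring
  have k2 : ∀ i, 2 * btz i / (x - z i) = -(2 / (z i - x) * btz i) := by
    intro i
    rw [← neg_sub (z i) x, div_neg]; ring
  have dbl : ∑ j, 2 / (z j - x) * ∑ i, 2 / (z i - y) * Fzz j i =
      ∑ j, 2 / (z j - y) * ∑ i, 2 / (z i - x) * Fzz j i := by
    simp only [Finset.mul_sum]
    rw [Finset.sum_comm]
    refine Finset.sum_congr rfl fun i _ => Finset.sum_congr rfl fun j _ => ?_
    rw [hs i j]; ring
  have first : 2 / (y - x) * ∑ i, 2 / (z i - y) ^ 2 * Fz i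
      + ∑ j, 2 / (z j - x) * (-2 / (z j - y) ^ 2 * Fz j)
      + 2 / (y - x) * ∑ i, 2 / (z i - x) ^ 2 * Fz i
      - ∑ j, 2 / (z j - y) * (-2 / (z j - x) ^ 2 * Fz j)
      + 4 / (y - x) ^ 2 * (∑ i, 2 / (z i - x) * Fz i - ∑ i, 2 / (z i - y) * Fz i) = 0 := by
    simp only [Finset.mul_sum, ← Finset.sum_add_distrib, ← Finset.sum_sub_distrib]
    refine Finset.sum_eq_zero fun i _ => ?_
    have h1 : z i - x ≠ 0 := sub_ne_zero.2 (hzx i)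
    have h2 : z i - y ≠ 0 := sub_ne_zero.2 (hzy i)
    field_simp
    ring
  have sp1 : ∑ j, 2 / (z j - x) * (κt / 2 * Fyyz j + (btz j * Fy + bt * Fyz j) +
        (2 / (x - y) * Fxz j) +
        (-2 / (z j - y) ^ 2 * Fz j + ∑ i, 2 / (z i - y) * Fzz j i)) =
      κt / 2 * ∑ j, 2 / (z j - x) * Fyyz j + Fy * ∑ j, 2 / (z j - x) * btz j +
      bt * ∑ j, 2 / (z j - x) * Fyz j + 2 / (x - y) * ∑ j, 2 / (z j - x) * Fxz j +
      ∑ j, 2 / (z j - x) * (-2 / (z j - y) ^ 2 * Fz j) +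
      ∑ j, 2 / (z j - x) * ∑ i, 2 / (z i - y) * Fzz j i := by
    rw [Finset.mul_sum (a := κt / 2), Finset.mul_sum (a := Fy), Finset.mul_sum (a := bt),
      Finset.mul_sum (a := 2 / (x - y))]
    simp only [← Finset.sum_add_distrib]
    refine Finset.sum_congr rfl fun i _ => ?_
    ring
  have sp2 : ∑ j, 2 / (z j - y) * (κ / 2 * Fxxz j + (bz j * Fx + b * Fxz j) +
        (2 / (y - x) * Fyz j) +
        (-2 / (z j - x) ^ 2 * Fz j + ∑ i, 2 / (z i - x) * Fzz j i)) =
      κ / 2 * ∑ j, 2 / (z j - y) * Fxxz j + Fx * ∑ j, 2 / (z j - y) * bz j +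
      b * ∑ j, 2 / (z j - y) * Fxz j + 2 / (y - x) * ∑ j, 2 / (z j - y) * Fyz j +
      ∑ j, 2 / (z j - y) * (-2 / (z j - x) ^ 2 * Fz j) +
      ∑ j, 2 / (z j - y) * ∑ i, 2 / (z i - x) * Fzz j i := by
    rw [Finset.mul_sum (a := κ / 2), Finset.mul_sum (a := Fx), Finset.mul_sum (a := b),
      Finset.mul_sum (a := 2 / (y - x))]
    simp only [← Finset.sum_add_distrib]
    refine Finset.sum_congr rfl fun i _ => ?_
    ring
  rw [sp1, sp2, dbl]
  simp only [k1, k2, Finset.sum_neg_distrib]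
  generalize ∑ j, 2 / (z j - y) * ∑ i, 2 / (z i - x) * Fzz j i = S1 at *
  generalize ∑ j, 2 / (z j - y) * (-2 / (z j - x) ^ 2 * Fz j) = S2 at *
  generalize ∑ j, 2 / (z j - x) * (-2 / (z j - y) ^ 2 * Fz j) = S3 at *
  generalize ∑ i, 2 / (z i - y) ^ 2 * Fz i = S4 at *
  generalize ∑ i, 2 / (z i - x) ^ 2 * Fz i = S5 at *
  rw [hr']
  generalize y - x = r at *
  have e1 : ∀ a : ℝ, a / -r = -(a * r⁻¹) := fun a => by rw [div_neg, div_eq_mul_inv]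
  have e2 : ∀ a : ℝ, a / (-r) ^ 2 = a * r⁻¹ ^ 2 := fun a => by
    rw [neg_sq, div_eq_mul_inv, inv_pow]
  have e3 : ∀ a : ℝ, a / (-r) ^ 3 = -(a * r⁻¹ ^ 3) := fun a => by
    rw [Odd.neg_pow (by decide), div_neg, div_eq_mul_inv, inv_pow]
  simp only [e1, e2, e3]
  linear_combination first

end

/-- Expansion of the commutator `[𝓛,𝓜] + (4/(y−x)²)(𝓛−𝓜)` of the two SLE generators. -/
theorem commutator_expansion (κ κt : ℝ) (hκ : 0 < κ) (hκt : 0 < κt)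
    (b bt : Config n → ℝ)
    (hb : ContDiffOn ℝ (⊤ : ℕ∞) b (distinctConfig n)) (hbt : ContDiffOn ℝ (⊤ : ℕ∞) bt (distinctConfig n))
    (F : Config n → ℝ) (hF : ContDiffOn ℝ (⊤ : ℕ∞) F (distinctConfig n))
    (p : Config n) (hp : p ∈ distinctConfig n) :
    opL n κ b (opM n κt bt F) p - opM n κt bt (opL n κ b F) p +
      4 / (p.2.1 - p.1) ^ 2 * (opL n κ b F p - opM n κt bt F p) =
    (κ * Dx n bt p - κt * Dy n b p) * Dx n (Dy n F) p +
      (2 * Dx n b p / (p.2.1 - p.1) + (∑ i, 2 * Dz n i b p / (p.2.1 - p.2.2 i)) -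
        bt p * Dy n b p + 2 * b p / (p.2.1 - p.1) ^ 2 +
        (2 * κ - 12) / (p.1 - p.2.1) ^ 3 - κt / 2 * Dy n (Dy n b) p) * Dx n F p -
      (2 * Dy n bt p / (p.1 - p.2.1) + (∑ i, 2 * Dz n i bt p / (p.1 - p.2.2 i)) -
        b p * Dx n bt p + 2 * bt p / (p.1 - p.2.1) ^ 2 +
        (2 * κt - 12) / (p.2.1 - p.1) ^ 3 - κ / 2 * Dx n (Dx n bt) p) * Dy n F p := by
  have hF' : Sm n F := hF
  have hb' : Sm n b := hb
  have hbt' : Sm n bt := hbt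
  have c2 := fun v w => DD_comm hF' v w hp
  have c3 : ∀ v w : Config n, DD n v (DD n w (DD n w F)) p = DD n w (DD n w (DD n v F)) p := by
    intro v w
    rw [DD_comm (hF'.DD w) v w hp, DD_congr (DD_comm hF' v w) w hp]
  have c4 : DD n (eY n) (DD n (eY n) (DD n (eX n) (DD n (eX n) F))) p =
      DD n (eX n) (DD n (eX n) (DD n (eY n) (DD n (eY n) F))) p := by
    have h3 : Set.EqOn (DD n (eY n) (DD n (eX n) (DD n (eX n) F)))
        (DD n (eX n) (DD n (eX n) (DD n (eY n) F))) (distinctConfig n) := by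
      intro q hq
      rw [DD_comm (hF'.DD _) _ _ hq, DD_congr (DD_comm hF' _ _) _ hq]
    rw [DD_congr h3 _ hp, DD_comm ((hF'.DD _).DD _) _ _ hp,
      DD_congr (DD_comm (hF'.DD _) _ _) _ hp]
  rw [LM_eq κ κt b bt hbt' F hF' p hp, ML_eq κ κt b bt hb' F hF' p hp,
    opL_eq κ b hF' hp, opM_eq κt bt hF' hp]
  simp only [PP, Dxx_eq hbt' hp, Dyy_eq hb' hp, Dxy_eq hF' hp, Dx_eq hF' hp, Dy_eq hF' hp,
    Dx_eq hb' hp, Dy_eq hb' hp, Dx_eq hbt' hp, Dy_eq hbt' hp, Dz_eq _ hb' hp, Dz_eq _ hbt' hp]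
  rw [c4]
  simp only [c3 (eY n) (eX n), c3 (eX n) (eY n), c3 (eZ n _) (eX n), c3 (eZ n _) (eY n),
    c2 (eY n) (eX n), c2 (eZ n _) (eX n), c2 (eZ n _) (eY n)]
  exact alg κ κt p.1 p.2.1 (b p) (bt p) _ _ _ _ _ _ _ _ _ _ _ _ _ _ _ _ p.2.2
    (fun i => DD n (eZ n i) b p) (fun i => DD n (eZ n i) bt p) (fun i => DD n (eZ n i) F p)
    (fun i => DD n (eX n) (DD n (eZ n i) F) p) (fun i => DD n (eY n) (DD n (eZ n i) F) p)
    (fun i => DD n (eX n) (DD n (eX n) (DD n (eZ n i) F)) p)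
    (fun i => DD n (eY n) (DD n (eY n) (DD n (eZ n i) F)) p)
    (fun i j => DD n (eZ n i) (DD n (eZ n j) F) p) hp.1 hp.2.1 hp.2.2.1 (fun i j => c2 _ _)
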